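/- Let p be prime and let m, n be integers with gcd(n, p) = 1. Then the Kloosterman-type sum ∑*_{γ mod p} e((mγ + n·γ̄)/p), where γ̄ is the inverse of γ mod p and the sum is over γ coprime to p, has absolute value at most 2·gcd(m, n, p)^{1/2}·p^{1/2}. -/

import Mathlib

open Complex

/-- `e(x) = exp(2πix)`. -/
noncomputable def e (x : ℝ) : ℂ := Complex.exp (2 * Real.pi * Complex.I * x)

section

open Polynomial

lemma natCard_degreeLT (K : Type*) [Field K] [Finite K] (n : ℕ) :
    Nat.card (degreeLT K n) = Nat.card K ^ n := by
  rw [Nat.card_congr (degreeLTEquiv K n).toEquiv, Nat.card_fun, Nat.card_fin]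

instance finite_degreeLT (K : Type*) [Field K] [Finite K] (n : ℕ) : Finite (degreeLT K n) :=
  Finite.of_equiv _ (degreeLTEquiv K n).toEquiv.symm

/-- A squarefree nonconstant polynomial is not a constant times a ratio of squares. -/
lemma eq_zero_of_sq_eq_C_mul_sq_mul {K : Type*} [Field K] {f u v : K[X]} {c : K} (hc : c ≠ 0)
    (hf : Squarefree f) (hd : 0 < f.natDegree) (h : u ^ 2 = C c * v ^ 2 * f) : v = 0 := by
  by_contra hv
  have hf0 : f ≠ 0 := by rintro rfl; simp at hd
  obtain ⟨π, hπ, hπf⟩ := exists_irreducible_of_natDegree_pos hd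
  have hu : u ≠ 0 := by
    rintro rfl
    have : C c * v ^ 2 * f ≠ 0 := mul_ne_zero (mul_ne_zero (by simpa) (pow_ne_zero _ hv)) hf0
    exact this (by rw [← h]; simp)
  have hp : Prime π := hπ.prime
  have h1 : multiplicity π f = 1 := by
    have hfin : FiniteMultiplicity π f := FiniteMultiplicity.of_prime_left hp hf0
    apply le_antisymm
    · by_contra hlt
      have h2 : π ^ 2 ∣ f := hfin.pow_dvd_iff_le_multiplicity.2 (by omega)
      exact hπ.not_isUnit (hf π (by rwa [← sq]))
    · exact hfin.pow_dvd_iff_le_multiplicity.1 (by simpa)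
  have hC : multiplicity π (C c) = 0 := by
    apply multiplicity_eq_zero.2
    intro hdv
    exact hπ.not_isUnit (isUnit_of_dvd_unit hdv (isUnit_C.2 (isUnit_iff_ne_zero.2 hc)))
  have hfin : ∀ g : K[X], g ≠ 0 → FiniteMultiplicity π g :=
    fun g hg => FiniteMultiplicity.of_prime_left hp hg
  have hCv : C c * v ^ 2 ≠ 0 := mul_ne_zero (by simpa) (pow_ne_zero _ hv)
  have key := congrArg (multiplicity π) h
  rw [multiplicity_mul hp (hfin _ (mul_ne_zero hCv hf0)), multiplicity_mul hp (hfin _ hCv),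
    hC, h1, (hfin u hu).multiplicity_pow hp, (hfin v hv).multiplicity_pow hp] at key
  omega

lemma X_pow_dvd_pow_char_pow_sub {K : Type*} [Field K] (p k : ℕ) [Fact p.Prime] [CharP K p]
    (f : K[X]) : X ^ p ^ k ∣ f ^ p ^ k - C (f.coeff 0 ^ p ^ k) := by
  have h : X ∣ f - C (f.coeff 0) := by simp [X_dvd_iff]
  have := pow_dvd_pow_of_dvd h (p ^ k)
  rwa [sub_pow_char_pow, ← C_pow] at this

/-- The auxiliary polynomial `∑ⱼ (uⱼ + vⱼ f^((P+1)/2)) X^(jP)` vanishes only if all its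
coefficients `uⱼ, vⱼ` do. -/
lemma eq_zero_of_sum_mul_X_pow_eq_zero {K : Type*} [Field K] (p k r : ℕ) [Fact p.Prime] [CharP K p]
    (hr : p ^ k = 2 * r + 1) {f : K[X]} (h0 : f.coeff 0 ≠ 0)
    (hf : Squarefree f) (hd : 0 < f.natDegree) {D : ℕ}
    (hD : 2 * D + f.natDegree ≤ 2 * r + 2) :
    ∀ (J : ℕ) (u v : ℕ → K[X]) (_ : ∀ j, u j ∈ degreeLT K D) (_ : ∀ j, v j ∈ degreeLT K D)
    (_ : ∑ j ∈ Finset.range J, (u j + v j * f ^ (r + 1)) * X ^ (j * (2 * r + 1)) = 0),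
    ∀ j < J, u j = 0 ∧ v j = 0 := by
  intro J
  induction J with
  | zero => intro u v _ _ _ j hj; omega
  | succ J ih =>
    intro u v hu hv h
    rw [Finset.sum_range_succ'] at h
    simp only [zero_mul, pow_zero, mul_one] at h
    have hsplit : ∑ j ∈ Finset.range J,
        (u (j + 1) + v (j + 1) * f ^ (r + 1)) * X ^ ((j + 1) * (2 * r + 1)) =
        (∑ j ∈ Finset.range J,
          (u (j + 1) + v (j + 1) * f ^ (r + 1)) * X ^ (j * (2 * r + 1))) * X ^ (2 * r + 1) := by
      rw [Finset.sum_mul]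
      refine Finset.sum_congr rfl fun j _ => ?_
      ring
    rw [hsplit] at h
    have hdvd : X ^ (2 * r + 1) ∣ u 0 + v 0 * f ^ (r + 1) := by
      refine ⟨-(∑ j ∈ Finset.range J,
          (u (j + 1) + v (j + 1) * f ^ (r + 1)) * X ^ (j * (2 * r + 1))), ?_⟩
      linear_combination h
    have hfP := X_pow_dvd_pow_char_pow_sub p k f
    rw [hr] at hfP
    set c := f.coeff 0 ^ (2 * r + 1) with hc
    have hdvd2 : X ^ (2 * r + 1) ∣ u 0 ^ 2 - C c * v 0 ^ 2 * f := by
      have h1 : u 0 ^ 2 - C c * v 0 ^ 2 * f = (u 0 + v 0 * f ^ (r + 1)) * (u 0 - v 0 * f ^ (r + 1))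
          + (f ^ (2 * r + 1) - C c) * (v 0 ^ 2 * f) := by ring
      rw [h1]
      exact dvd_add (hdvd.mul_right _) (hfP.mul_right _)
    have hz : ∀ w : K[X], w ∈ degreeLT K D → w = 0 ∨ w.natDegree < D := by
      intro w hw
      rw [mem_degreeLT] at hw
      by_cases hw0 : w = 0
      · exact Or.inl hw0
      · exact Or.inr ((natDegree_lt_iff_degree_lt hw0).2 hw)
    have hlt : u 0 ^ 2 - C c * v 0 ^ 2 * f = 0 := by
      refine eq_zero_of_dvd_of_natDegree_lt hdvd2 ?_
      rw [natDegree_X_pow]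
      refine lt_of_le_of_lt (natDegree_sub_le _ _) (max_lt ?_ ?_)
      · rcases hz _ (hu 0) with h | h
        · simp [h]
        · rw [natDegree_pow]; omega
      · rcases hz _ (hv 0) with h | h
        · simp [h]
        · refine lt_of_le_of_lt (natDegree_mul_le) ?_
          have := natDegree_C_mul_le c (v 0 ^ 2)
          rw [natDegree_pow] at this
          omega
    have hv0 : v 0 = 0 :=
      eq_zero_of_sq_eq_C_mul_sq_mul (pow_ne_zero _ h0) hf hd (sub_eq_zero.1 hlt)
    have hu0 : u 0 = 0 := by
      simpa [hv0] using hlt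
    have hrest := ih (fun j => u (j + 1)) (fun j => v (j + 1)) (fun j => hu _) (fun j => hv _) (by
      rw [hu0, hv0, zero_mul, add_zero, add_zero] at h
      exact (mul_eq_zero.1 h).resolve_right (pow_ne_zero _ X_ne_zero))
    intro j hj
    cases j with
    | zero => exact ⟨hu0, hv0⟩
    | succ j => exact hrest j (by omega)

/-- Stepanov's method for `y² = f(x)`, over a field with `P²` elements. -/
theorem two_mul_card_nonresidue_le {K : Type*} [Field K] [Fintype K] [DecidableEq K] (p k r μ : ℕ)
    [Fact p.Prime] [CharP K p] (hr : p ^ k = 2 * r + 1) (hK : Fintype.card K = (2 * r + 1) ^ 2)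
    {f : K[X]} (h0 : f.coeff 0 ≠ 0) (hf : Squarefree f) (hd : 0 < f.natDegree)
    (hμ : f.natDegree ≤ 2 * μ) (hP : 4 * μ < 2 * r + 1) :
    2 * (Finset.univ.filter fun x : K => f.eval x ^ (Fintype.card K / 2) = -1).card ≤
      (2 * r + 1) ^ 2 + 6 * μ * (2 * r + 1) := by
  set D := r + 1 - μ with hDdef
  set J := r + 2 * μ with hJdef
  have hDr : D + μ = r + 1 := by omega
  have hD1 : 1 ≤ D := by omega
  have hμ1 : 1 ≤ μ := by omega
  set M := (2 * r + 1) * (D - 1) + 2 * μ * (r + 1) + J with hM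
  have hML : M < 2 * (J * D) := by
    obtain ⟨d, hd⟩ : ∃ d, D = d + 1 := ⟨D - 1, by omega⟩
    have hrd : r = d + μ := by omega
    have hdμ : 2 * μ ≤ 2 * d := by omega
    rw [hM, hd, hJdef, hrd, Nat.add_sub_cancel]
    nlinarith

  let G : (Fin J → degreeLT K D) × (Fin J → degreeLT K D) → K[X] := fun w => ∑ j : Fin J,
    (((w.1 j : K[X])) ^ p ^ k - (w.2 j : K[X]) ^ p ^ k * f ^ (r + 1)) * X ^ (j : ℕ)
  have hGsub : ∀ w w', G (w - w') = G w - G w' := by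
    intro w w'
    simp only [G, ← Finset.sum_sub_distrib]
    refine Finset.sum_congr rfl fun j _ => ?_
    simp only [Prod.fst_sub, Prod.snd_sub, Pi.sub_apply, Submodule.coe_sub, sub_pow_char_pow]
    ring
  have hz : ∀ w : degreeLT K D, (w : K[X]).natDegree ≤ D - 1 := by
    intro w
    have hw := w.2
    rw [mem_degreeLT] at hw
    by_cases hw0 : (w : K[X]) = 0
    · simp [hw0]
    · have := (natDegree_lt_iff_degree_lt hw0).2 hw
      omega
  have hfr : (f ^ (r + 1)).natDegree ≤ 2 * μ * (r + 1) := by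
    rw [natDegree_pow, mul_comm]
    exact Nat.mul_le_mul_right _ hμ
  have hGdeg : ∀ w, G w ∈ degreeLT K M := by
    intro w
    refine Submodule.sum_mem _ fun j _ => ?_
    rw [mem_degreeLT]
    refine lt_of_le_of_lt degree_le_natDegree ?_
    norm_cast
    have hj := j.2
    have h1 : ((w.1 j : K[X]) ^ p ^ k).natDegree ≤ (2 * r + 1) * (D - 1) := by
      rw [natDegree_pow, hr]; exact Nat.mul_le_mul_left _ (hz _)
    have h2 : ((w.2 j : K[X]) ^ p ^ k).natDegree ≤ (2 * r + 1) * (D - 1) := by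
      rw [natDegree_pow, hr]; exact Nat.mul_le_mul_left _ (hz _)
    have h3 : (((w.2 j : K[X])) ^ p ^ k * f ^ (r + 1)).natDegree ≤
        (2 * r + 1) * (D - 1) + 2 * μ * (r + 1) := natDegree_mul_le.trans (add_le_add h2 hfr)
    have h4 := natDegree_sub_le ((w.1 j : K[X]) ^ p ^ k) ((w.2 j : K[X]) ^ p ^ k * f ^ (r + 1))
    have h5 := h4.trans (max_le (h1.trans (Nat.le_add_right _ _)) h3)
    refine lt_of_le_of_lt natDegree_mul_le ?_
    rw [natDegree_X_pow]
    omega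
  obtain ⟨w, hw0, hw⟩ : ∃ w : (Fin J → degreeLT K D) × (Fin J → degreeLT K D), w ≠ 0 ∧ G w = 0 := by
    have hcard : Nat.card (degreeLT K M) <
        Nat.card ((Fin J → degreeLT K D) × (Fin J → degreeLT K D)) := by
      rw [Nat.card_prod, natCard_degreeLT, Nat.card_fun, natCard_degreeLT, Nat.card_fin, ← pow_mul,
        ← pow_add]
      apply Nat.pow_lt_pow_right Finite.one_lt_card
      rw [mul_comm D J]; omega
    by_contra hcon
    push Not at hcon
    have hinj : Function.Injective (fun w : (Fin J → degreeLT K D) × (Fin J → degreeLT K D) =>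
        (⟨G w, hGdeg w⟩ : degreeLT K M)) := by
      intro a b hab
      by_contra hne
      apply hcon (a - b) (sub_ne_zero.2 hne)
      rw [hGsub, sub_eq_zero]
      exact congrArg Subtype.val hab
    exact absurd (Nat.card_le_card_of_injective _ hinj) (not_le.2 hcard)
  let H : K[X] := ∑ j : Fin J,
    ((w.1 j : K[X]) + (w.2 j : K[X]) * f ^ (r + 1)) * X ^ ((j : ℕ) * (2 * r + 1))
  have hH0 : H ≠ 0 := by
    intro hH
    apply hw0
    let u : ℕ → K[X] := fun j => if h : j < J then (w.1 ⟨j, h⟩ : K[X]) else 0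
    let v : ℕ → K[X] := fun j => if h : j < J then (w.2 ⟨j, h⟩ : K[X]) else 0
    have hu : ∀ j, u j ∈ degreeLT K D := by
      intro j
      simp only [u]
      split_ifs
      · exact (w.1 _).2
      · exact Submodule.zero_mem _
    have hv : ∀ j, v j ∈ degreeLT K D := by
      intro j
      simp only [v]
      split_ifs
      · exact (w.2 _).2
      · exact Submodule.zero_mem _
    have hall := eq_zero_of_sum_mul_X_pow_eq_zero p k r hr h0 hf hd (D := D) (by omega) J u v hu hv
      (by
        rw [Finset.sum_range, ← hH]
        refine Finset.sum_congr rfl fun j _ => ?_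
        simp [u, v])
    refine Prod.ext (funext fun j => Subtype.ext ?_) (funext fun j => Subtype.ext ?_)
    · simpa [u] using (hall j j.2).1
    · simpa [v] using (hall j j.2).2
  have hHdeg : 2 * H.natDegree ≤ (2 * r + 1) ^ 2 + 6 * μ * (2 * r + 1) := by
    have hle : H.natDegree ≤ (D - 1) + 2 * μ * (r + 1) + (J - 1) * (2 * r + 1) := by
      refine natDegree_sum_le_of_forall_le _ _ fun j _ => ?_
      have hj := j.2
      refine natDegree_mul_le.trans (add_le_add ?_ ?_)
      · refine (natDegree_add_le _ _).trans (max_le ((hz _).trans (Nat.le_add_right _ _)) ?_)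
        exact natDegree_mul_le.trans (add_le_add (hz _) hfr)
      · rw [natDegree_X_pow]
        exact Nat.mul_le_mul_right _ (by omega)
    obtain ⟨d, hd⟩ : ∃ d, D = d + 1 := ⟨D - 1, by omega⟩
    obtain ⟨m, hm⟩ : ∃ m, μ = m + 1 := ⟨μ - 1, by omega⟩
    have hrd : r = d + μ := by omega
    have hJ1 : J - 1 = d + 3 * m + 2 := by omega
    rw [hJ1, hd, Nat.add_sub_cancel] at hle
    subst hrd
    subst hm
    nlinarith
  refine le_trans (Nat.mul_le_mul_left 2 ?_) hHdeg
  have hsub : (Finset.univ.filter fun x : K => f.eval x ^ (Fintype.card K / 2) = -1) ⊆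
      H.roots.toFinset := by
    intro x hx
    rw [Finset.mem_filter] at hx
    rw [Multiset.mem_toFinset, mem_roots hH0, IsRoot.def]
    have hx1 := hx.2
    have hKh : Fintype.card K / 2 = 2 * r * r + 2 * r := by
      rw [hK]
      have : (2 * r + 1) ^ 2 = 2 * (2 * r * r + 2 * r) + 1 := by ring
      omega
    rw [hKh] at hx1
    apply pow_eq_zero_iff (n := p ^ k) (by rw [hr]; omega) |>.1
    have hxq : x ^ ((2 * r + 1) * (2 * r + 1)) = x := by
      rw [← sq, ← hK, FiniteField.pow_card]
    have hGx := congrArg (eval x) hw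
    simp only [G, eval_finsetSum, eval_mul, eval_sub, eval_pow, eval_X, eval_zero] at hGx
    rw [← hGx]
    have : ExpChar K p := ExpChar.prime Fact.out
    simp only [H, eval_finsetSum, eval_mul, eval_add, eval_pow, eval_X, sum_pow_char_pow]
    refine Finset.sum_congr rfl fun j _ => ?_
    rw [mul_pow, add_pow_char_pow, mul_pow]
    have e1 : (x ^ ((j : ℕ) * (2 * r + 1))) ^ p ^ k = x ^ (j : ℕ) := by
      rw [hr, ← pow_mul, mul_assoc, mul_comm, pow_mul, hxq]
    have e2 : (eval x f ^ (r + 1)) ^ p ^ k = - eval x f ^ (r + 1) := by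
      rw [hr, ← pow_mul, show (r + 1) * (2 * r + 1) = (2 * r * r + 2 * r) + (r + 1) by ring,
        pow_add, hx1]
      ring
    rw [e1, e2]
    ring
  exact (Finset.card_le_card hsub).trans ((Multiset.toFinset_card_le _).trans (card_roots' _))

lemma trace_pow_char {p : ℕ} [Fact p.Prime] {K : Type*} [Field K] [Finite K] [Algebra (ZMod p) K]
    (y : K) : Algebra.trace (ZMod p) K (y ^ p) = Algebra.trace (ZMod p) K y := by
  have := Algebra.trace_eq_of_algEquiv (FiniteField.frobeniusAlgEquivOfAlgebraic (ZMod p) K) y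
  rwa [FiniteField.coe_frobeniusAlgEquivOfAlgebraic, ZMod.card] at this

lemma artinSchreier_sq_sub_squarefree {K : Type*} [Field K] {p : ℕ} [Fact p.Prime] [CharP K p]
    {c : K} (hc : c ≠ 0) (h2 : (2 : K) ≠ 0) : Squarefree ((X ^ p - X : K[X]) ^ 2 - C c) := by
  apply Separable.squarefree
  have hder : derivative ((X ^ p - X : K[X]) ^ 2 - C c) = C (-2) * (X ^ p - X) := by
    simp only [derivative_sub, derivative_pow, derivative_X, derivative_C, CharP.cast_eq_zero]
    simp [C_ofNat]
  rw [Separable, hder]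
  refine ⟨C (-c⁻¹), C (-(2 * c)⁻¹) * (X ^ p - X), ?_⟩
  have e1 : (C (-c⁻¹) : K[X]) * C c = -1 := by
    rw [← C_mul, neg_mul, inv_mul_cancel₀ hc, C_neg, C_1]
  have e2 : (C (-(2 * c)⁻¹) : K[X]) * C (-2) = - C (-c⁻¹) := by
    rw [← C_mul, ← C_neg]
    congr 1
    field_simp
  linear_combination -e1 + (X ^ p - X : K[X]) ^ 2 * e2

lemma natDegree_artinSchreier_sq_sub {K : Type*} [Field K] {p : ℕ} (hp : 1 < p) (c : K) :
    ((X ^ p - X : K[X]) ^ 2 - C c).natDegree = 2 * p := by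
  rw [natDegree_sub_C, natDegree_pow, FiniteField.X_pow_card_sub_X_natDegree_eq K hp]

/-- Lower bound for the number of `x` such that `y ^ p - y = a x + b / x` is solvable. -/
theorem card_le_mul_card_trace_eq_zero {p : ℕ} [Fact p.Prime] (hp2 : p ≠ 2) {K : Type*} [Field K]
    [Fintype K] [DecidableEq K] [Algebra (ZMod p) K] {k r : ℕ} (hr : p ^ k = 2 * r + 1)
    (hK : Fintype.card K = (2 * r + 1) ^ 2) (hP : 4 * p < 2 * r + 1) {a b : ZMod p}
    (ha : a ≠ 0) (hb : b ≠ 0) :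
    (2 * r + 1) ^ 2 ≤ p * (Finset.univ.filter fun x : K => x ≠ 0 ∧
      Algebra.trace (ZMod p) K (a • x + b • x⁻¹) = 0).card + 10 * p * (2 * r + 1) := by
  have hp : p.Prime := Fact.out
  have hchar : CharP K p := charP_of_injective_algebraMap (algebraMap (ZMod p) K).injective p
  have h2 : (2 : K) ≠ 0 := Ring.two_ne_zero (by rwa [ringChar.eq K p])
  simp only [Algebra.smul_def]
  obtain ⟨A, hA⟩ : ∃ A, A = algebraMap (ZMod p) K a := ⟨_, rfl⟩
  obtain ⟨B, hB⟩ : ∃ B, B = algebraMap (ZMod p) K b := ⟨_, rfl⟩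
  rw [← hA, ← hB]
  have hA0 : A ≠ 0 := by rw [hA]; simpa
  have hB0 : B ≠ 0 := by rw [hB]; simpa
  set f : K[X] := (X ^ p - X) ^ 2 - C (4 * A * B) with hf
  have hc : 4 * A * B ≠ 0 := by
    have : (4 : K) = 2 * 2 := by norm_num
    rw [this]; simp [h2, hA0, hB0]
  have hf0 : f.coeff 0 ≠ 0 := by
    rw [coeff_zero_eq_eval_zero, hf]
    simpa [hp.ne_zero, h2, hA0, hB0] using hc
  have hfd : f.natDegree = 2 * p := natDegree_artinSchreier_sq_sub hp.one_lt _
  have hfev : ∀ y, f.eval y = (y ^ p - y) ^ 2 - 4 * A * B := by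
    intro y; simp [hf]
  have hN := two_mul_card_nonresidue_le p k r p hr hK hf0 (artinSchreier_sq_sub_squarefree hc h2)
    (by rw [hfd]; have := hp.pos; omega) hfd.le hP
  set N₁ := Finset.univ.filter fun x : K => f.eval x ^ (Fintype.card K / 2) = 1 with hN1
  set N₂ := Finset.univ.filter fun x : K => f.eval x ^ (Fintype.card K / 2) = -1
  have hfne : f ≠ 0 := by rintro h; simp [h] at hf0
  have hrc : ringChar K ≠ 2 := by rwa [ringChar.eq K p]
  have hcov : (2 * r + 1) ^ 2 ≤ N₁.card + N₂.card + 2 * p := by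
    have hsub : (Finset.univ : Finset K) ⊆ N₁ ∪ N₂ ∪ f.roots.toFinset := by
      intro y _
      simp only [N₁, N₂, Finset.mem_union, Finset.mem_filter, Finset.mem_univ, true_and,
        Multiset.mem_toFinset, mem_roots hfne, IsRoot.def]
      by_cases hy : f.eval y = 0
      · exact Or.inr hy
      · exact Or.inl (FiniteField.pow_dichotomy hrc hy)
    have h := Finset.card_le_card hsub
    rw [Finset.card_univ, hK] at h
    have h1 := Finset.card_union_le (N₁ ∪ N₂) f.roots.toFinset
    have h2 := Finset.card_union_le N₁ N₂
    have h3 := (Multiset.toFinset_card_le f.roots).trans (card_roots' f)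
    omega
  set T := Finset.univ.filter fun x : K => x ≠ 0 ∧
      Algebra.trace (ZMod p) K (A * x + B * x⁻¹) = 0 with hT
  let S : Finset (K × K) := Finset.univ.filter fun z => z.1 ≠ 0 ∧ A * z.1 + B * z.1⁻¹ = z.2 ^ p - z.2
  have hST : S.card ≤ p * T.card := by
    apply Finset.card_le_mul_card_image_of_maps_to (f := Prod.fst)
    · intro z hz
      simp only [S, T, Finset.mem_filter, Finset.mem_univ, true_and] at hz ⊢
      refine ⟨hz.1, ?_⟩
      rw [hz.2, map_sub, trace_pow_char, sub_self]
    · intro x _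
      set c := A * x + B * x⁻¹ with hc
      have hg : (X ^ p - X - C c : K[X]).natDegree = p := by
        rw [natDegree_sub_C, FiniteField.X_pow_card_sub_X_natDegree_eq K hp.one_lt]
      have hg0 : (X ^ p - X - C c : K[X]) ≠ 0 := by
        intro h; rw [h, natDegree_zero] at hg; exact hp.ne_zero hg.symm
      calc _ ≤ (X ^ p - X - C c : K[X]).roots.toFinset.card := by
            apply Finset.card_le_card_of_injOn Prod.snd
            · intro z hz
              simp only [S, Finset.coe_filter, Finset.mem_filter, Finset.mem_univ, true_and,
                Set.mem_ofPred_eq] at hz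
              rw [Finset.mem_coe, Multiset.mem_toFinset, mem_roots hg0]
              obtain ⟨⟨_, h1⟩, h2⟩ := hz
              rw [h2] at h1
              simp [hc, h1]
            · intro z hz z' hz' h
              simp only [Finset.coe_filter, Set.mem_ofPred_eq] at hz hz'
              exact Prod.ext (hz.2.trans hz'.2.symm) h
        _ ≤ p := by
            refine (Multiset.toFinset_card_le _).trans ((card_roots' _).trans hg.le)
  have hSN : N₁.card * 2 ≤ S.card := by
    have hsub : (S.filter fun z => z.2 ∈ N₁).card ≤ S.card := Finset.card_filter_le _ _
    refine le_trans ?_ hsub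
    rw [Finset.card_eq_sum_card_fiberwise (f := Prod.snd) (t := N₁)
      (fun z hz => Finset.mem_coe.2 (Finset.mem_filter.1 (Finset.mem_coe.1 hz)).2)]
    rw [← smul_eq_mul]
    refine Finset.card_nsmul_le_sum _ _ _ fun y hy => ?_
    have hy1 := (Finset.mem_filter.1 hy).2
    have hne : f.eval y ≠ 0 := by
      intro h
      rw [h, zero_pow] at hy1
      · exact zero_ne_one hy1
      · have : 1 < Fintype.card K := Fintype.one_lt_card
        omega
    obtain ⟨s, hs⟩ := (FiniteField.isSquare_iff hrc hne).2 hy1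
    have hs0 : s ≠ 0 := by rintro rfl; simp at hs; exact hne hs
    rw [hfev] at hs
    have hmem : ∀ s' : K, s' * s' = s * s → ((y ^ p - y + s') / (2 * A), y) ∈
        (S.filter fun z => z.2 ∈ N₁).filter fun z => z.2 = y := by
      intro s' hs'
      simp only [S, Finset.mem_filter, Finset.mem_univ, true_and, and_true]
      refine ⟨?_, hy⟩
      rw [← hs] at hs'
      have hx0 : y ^ p - y + s' ≠ 0 := by
        intro h
        apply hc
        linear_combination (y ^ p - y - s') * h + hs'
      refine ⟨div_ne_zero hx0 (mul_ne_zero h2 hA0), ?_⟩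
      field_simp
      linear_combination hs'
    have h1 := hmem s rfl
    have h2' := hmem (-s) (by ring)
    have hpair : ({((y ^ p - y + s) / (2 * A), y), ((y ^ p - y + -s) / (2 * A), y)} :
        Finset (K × K)).card = 2 := by
      apply Finset.card_pair
      intro h
      have h := congrArg Prod.fst h
      simp only at h
      rw [div_left_inj' (mul_ne_zero h2 hA0)] at h
      have : 2 * s = 0 := by linear_combination h
      exact (mul_ne_zero h2 hs0) this
    rw [← hpair]
    apply Finset.card_le_card
    intro z hz
    rw [Finset.mem_insert, Finset.mem_singleton] at hz
    rcases hz with rfl | rfl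
    · exact h1
    · exact h2'
  nlinarith

noncomputable instance fintypeGaloisField (p n : ℕ) [Fact p.Prime] : Fintype (GaloisField p n) :=
  Fintype.ofFinite _

section LFunction

variable {F : Type*} [Field F]

/-- The completely multiplicative function on monic polynomials attached to the Kloosterman sum:
it sends `f` to `ψ (∑ (a x + b / x))`, the sum being over the roots of `f`. -/
noncomputable def kloostermanWeight (ψ : AddChar F ℂ) (a b : F) (f : F[X]) : ℂ :=
  open Classical in
  if f.coeff 0 = 0 then 0 else ψ (-(a * f.nextCoeff + b * (f.coeff 1 / f.coeff 0)))

lemma kloostermanWeight_mul (ψ : AddChar F ℂ) (a b : F) {f g : F[X]} (hf : f.Monic)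
    (hg : g.Monic) : kloostermanWeight ψ a b (f * g) =
      kloostermanWeight ψ a b f * kloostermanWeight ψ a b g := by
  unfold kloostermanWeight
  rw [mul_coeff_zero, hf.nextCoeff_mul hg, mul_coeff_one]
  by_cases h1 : f.coeff 0 = 0
  · simp [h1]
  by_cases h2 : g.coeff 0 = 0
  · simp [h2]
  rw [if_neg (mul_ne_zero h1 h2), if_neg h1, if_neg h2, ← AddChar.map_add_eq_mul]
  congr 1
  field_simp
  ring

lemma kloostermanWeight_one (ψ : AddChar F ℂ) (a b : F) : kloostermanWeight ψ a b 1 = 1 := by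
  simp [kloostermanWeight, nextCoeff, coeff_one]

lemma kloostermanWeight_pow (ψ : AddChar F ℂ) (a b : F) {f : F[X]} (hf : f.Monic) (k : ℕ) :
    kloostermanWeight ψ a b (f ^ k) = kloostermanWeight ψ a b f ^ k := by
  induction k with
  | zero => simp [kloostermanWeight_one]
  | succ k ih => rw [pow_succ, kloostermanWeight_mul ψ a b (hf.pow k) hf, ih, pow_succ]

lemma adjoin_simple_inv (F : Type*) [Field F] {K : Type*} [Field K] [Algebra F K] (x : K) :
    IntermediateField.adjoin F {x⁻¹} = IntermediateField.adjoin F {x} := by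
  apply le_antisymm
  · rw [IntermediateField.adjoin_simple_le_iff]
    exact inv_mem (IntermediateField.mem_adjoin_simple_self F x)
  · rw [IntermediateField.adjoin_simple_le_iff]
    have := inv_mem (IntermediateField.mem_adjoin_simple_self F x⁻¹)
    rwa [inv_inv] at this

lemma nextCoeff_minpoly_inv {K : Type*} [Field K] [Algebra F K] [FiniteDimensional F K] {x : K}
    (hx : x ≠ 0) : (minpoly F x⁻¹).nextCoeff = (minpoly F x).coeff 1 / (minpoly F x).coeff 0 := by
  have hint : IsIntegral F x := Algebra.IsIntegral.isIntegral x
  set P := minpoly F x with hP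
  have hc0 : P.coeff 0 ≠ 0 := minpoly.coeff_zero_ne_zero hint hx
  have hPm : P.Monic := minpoly.monic hint
  have hdeg : (minpoly F x⁻¹).natDegree = P.natDegree := by
    rw [← IntermediateField.adjoin.finrank (Algebra.IsIntegral.isIntegral x⁻¹), adjoin_simple_inv F x,
      IntermediateField.adjoin.finrank hint]
  have htr : P.natTrailingDegree = 0 := natTrailingDegree_eq_zero.2 (Or.inr hc0)
  have hrd : P.reverse.natDegree = P.natDegree := by rw [reverse_natDegree, htr, Nat.sub_zero]
  have hC : (P.coeff 0)⁻¹ ≠ 0 := inv_ne_zero hc0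
  have hmon : (C (P.coeff 0)⁻¹ * P.reverse).Monic := by
    rw [Monic, leadingCoeff_mul, leadingCoeff_C, reverse_leadingCoeff, trailingCoeff, htr,
      inv_mul_cancel₀ hc0]
  have hnd : (C (P.coeff 0)⁻¹ * P.reverse).natDegree = P.natDegree := by
    rw [natDegree_C_mul hC, hrd]
  have hev : aeval x⁻¹ (C (P.coeff 0)⁻¹ * P.reverse) = 0 := by
    let _ : Invertible x := invertibleOfNonzero hx
    have h := (eval₂_reverse_eq_zero_iff (algebraMap F K) x P).2 (minpoly.aeval F x)
    rw [invOf_eq_inv] at h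
    rw [map_mul, aeval_def x⁻¹ P.reverse, h, mul_zero]
  have huniq := minpoly.unique_of_degree_le_degree_minpoly F x⁻¹ hmon hev (by
    rw [degree_eq_natDegree hmon.ne_zero, hnd,
      degree_eq_natDegree (minpoly.ne_zero (Algebra.IsIntegral.isIntegral x⁻¹)), hdeg])
  have hpos : 0 < P.natDegree := minpoly.natDegree_pos hint
  rw [← huniq, nextCoeff_of_natDegree_pos (by rw [hnd]; exact hpos), hnd, coeff_C_mul,
    coeff_reverse, revAt_le (by omega), show P.natDegree - (P.natDegree - 1) = 1 by omega]
  field_simp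

/-- The characteristic polynomial of `x` acting on an extension of degree `n`. -/
noncomputable def minpolyPow (F : Type*) [Field F] {K : Type*} [Field K] [Algebra F K] (n : ℕ)
    (x : K) : F[X] :=
  minpoly F x ^ (n / (minpoly F x).natDegree)

lemma kloostermanWeight_minpolyPow (ψ : AddChar F ℂ) (a b : F) {K : Type*} [Field K] [Algebra F K]
    [FiniteDimensional F K] [DecidableEq K] (x : K) :
    kloostermanWeight ψ a b (minpolyPow F (Module.finrank F K) x) =
      if x = 0 then 0 else ψ (Algebra.trace F K (a • x + b • x⁻¹)) := by
  have hint : IsIntegral F x := Algebra.IsIntegral.isIntegral x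
  have hdvd := minpoly.degree_dvd hint
  have hpos : 0 < (minpoly F x).natDegree := minpoly.natDegree_pos hint
  have hfin : 0 < Module.finrank F K := Module.finrank_pos
  rw [minpolyPow, kloostermanWeight_pow _ _ _ (minpoly.monic hint)]
  split_ifs with hx
  · subst hx
    rw [minpoly.zero]
    have : 0 < Module.finrank F K / (X : F[X]).natDegree := by rwa [natDegree_X, Nat.div_one]
    simp only [kloostermanWeight, coeff_X_zero, if_true]
    exact zero_pow this.ne'
  · have hc0 : (minpoly F x).coeff 0 ≠ 0 := minpoly.coeff_zero_ne_zero hint hx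
    have hq : Module.finrank (IntermediateField.adjoin F {x}) K =
        Module.finrank F K / (minpoly F x).natDegree := by
      rw [← IntermediateField.adjoin.finrank hint,
        ← Module.finrank_mul_finrank F (IntermediateField.adjoin F {x}) K, Nat.mul_div_cancel_left]
      exact Module.finrank_pos
    rw [kloostermanWeight, if_neg hc0, ← AddChar.map_nsmul_eq_pow, map_add,
      map_smul (Algebra.trace F K) a, map_smul (Algebra.trace F K) b,
      trace_eq_finrank_mul_minpoly_nextCoeff F x, trace_eq_finrank_mul_minpoly_nextCoeff F x⁻¹,
      nextCoeff_minpoly_inv hx, adjoin_simple_inv F x, hq]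
    congr 1
    simp only [nsmul_eq_mul, smul_eq_mul]
    ring

lemma card_filter_minpoly_eq [Finite F] {K : Type*} [Field K] [Fintype K] [Algebra F K]
    [DecidableEq F[X]] {P : F[X]} (hP : Irreducible P) (hPm : P.Monic) :
    (Finset.univ.filter fun x : K => minpoly F x = P).card =
      if P.natDegree ∣ Module.finrank F K then P.natDegree else 0 := by
  classical
  have hfd : FiniteDimensional F K := Module.Finite.of_finite
  split_ifs with h
  · have hdvd := hP.natDegree_dvd_iff_dvd_X_pow_card_pow_sub_X.1 h
    rw [← Module.natCard_eq_pow_finrank (K := F) (V := K)] at hdvd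
    have hsplit : (P.map (algebraMap F K)).Splits := by
      have h1 := Polynomial.splits_X_pow_nat_card_sub_X (K := K)
      refine h1.of_dvd ?_ ?_
      · exact FiniteField.X_pow_card_sub_X_ne_zero _ Finite.one_lt_card
      · have := Polynomial.map_dvd (algebraMap F K) hdvd
        simpa using this
    rw [← card_rootSet_eq_natDegree (PerfectField.separable_of_irreducible hP) hsplit,
      Fintype.card_subtype]
    congr 1
    ext x
    simp only [Finset.mem_filter, Finset.mem_univ, true_and, mem_rootSet]
    constructor
    · rintro rfl
      exact ⟨hPm.ne_zero, minpoly.aeval F x⟩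
    · rintro ⟨_, h⟩
      exact (minpoly.eq_of_irreducible_of_monic hP h hPm).symm
  · rw [Finset.card_eq_zero, Finset.filter_eq_empty_iff]
    rintro x _ rfl
    exact h (minpoly.degree_dvd (Algebra.IsIntegral.isIntegral x))

lemma card_filter_dvd_div_le {d e v : ℕ} (he : 0 < e) (hv : v * e ≤ d) :
    ((Finset.Icc 1 d).filter fun n => e ∣ n ∧ n / e ≤ v).card = v := by
  have : (Finset.Icc 1 d).filter (fun n => e ∣ n ∧ n / e ≤ v) =
      (Finset.Icc 1 v).image (fun k => k * e) := by
    ext n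
    simp only [Finset.mem_filter, Finset.mem_Icc, Finset.mem_image]
    constructor
    · rintro ⟨⟨h1, h2⟩, ⟨k, rfl⟩, h3⟩
      rw [Nat.mul_div_cancel_left _ he] at h3
      refine ⟨k, ⟨?_, h3⟩, mul_comm _ _⟩
      exact Nat.pos_of_mul_pos_left h1
    · rintro ⟨k, ⟨h1, h2⟩, rfl⟩
      rw [Nat.mul_div_cancel _ he]
      exact ⟨⟨Nat.mul_pos h1 he, (Nat.mul_le_mul_right _ h2).trans hv⟩, dvd_mul_left _ _, h2⟩
  rw [this, Finset.card_image_of_injective _ (mul_left_injective₀ he.ne'), Nat.card_Icc]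
  omega

end LFunction

section Recurrence

open UniqueFactorizationMonoid

variable {p : ℕ} [Fact p.Prime]

lemma minpolyPow_monic_natDegree {n : ℕ} (hn : n ≠ 0) (x : GaloisField p n) :
    (minpolyPow (ZMod p) n x).Monic ∧ (minpolyPow (ZMod p) n x).natDegree = n := by
  have hint : IsIntegral (ZMod p) x := Algebra.IsIntegral.isIntegral x
  refine ⟨(minpoly.monic hint).pow _, ?_⟩
  have := minpoly.degree_dvd hint
  rw [GaloisField.finrank p hn] at this
  rw [minpolyPow, natDegree_pow, Nat.div_mul_cancel this]

open Classical in
/-- The degree of `f` counts the finite field elements whose characteristic polynomial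
divides `f`. -/
lemma sum_card_minpolyPow_dvd {f : (ZMod p)[X]} (hf : f.Monic) :
    ∑ n ∈ Finset.Icc 1 f.natDegree,
      (Finset.univ.filter fun x : GaloisField p n => minpolyPow (ZMod p) n x ∣ f).card =
      f.natDegree := by
  set s := (normalizedFactors f).toFinset with hs
  have hmem : ∀ P, P ∈ s ↔ Irreducible P ∧ P.Monic ∧ P ∣ f := by
    intro P
    rw [hs, Multiset.mem_toFinset, Polynomial.mem_normalizedFactors_iff hf.ne_zero]
  have hprod : (normalizedFactors f).prod = f := by
    rw [prod_normalizedFactors_eq hf.ne_zero, hf.normalize_eq_self]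
  have hdeg : f.natDegree = ∑ P ∈ s, (normalizedFactors f).count P * P.natDegree := by
    conv_lhs => rw [← hprod]
    rw [natDegree_multiset_prod _ (zero_notMem_normalizedFactors f),
      Finset.sum_multiset_map_count]
    simp [hs]
  have hfib : ∀ n ∈ Finset.Icc 1 f.natDegree,
      (Finset.univ.filter fun x : GaloisField p n => minpolyPow (ZMod p) n x ∣ f).card =
      ∑ P ∈ s, if P.natDegree ∣ n ∧ n / P.natDegree ≤ (normalizedFactors f).count P
        then P.natDegree else 0 := by
    intro n hn
    have hn0 : n ≠ 0 := by have := (Finset.mem_Icc.1 hn).1; omega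
    rw [Finset.card_eq_sum_card_fiberwise (f := fun x => minpoly (ZMod p) x) (t := s)]
    · refine Finset.sum_congr rfl fun P hP => ?_
      obtain ⟨hirr, hmon, _⟩ := (hmem P).1 hP
      have hiff : P ^ (n / P.natDegree) ∣ f ↔
          n / P.natDegree ≤ (normalizedFactors f).count P := by
        rw [pow_dvd_iff_le_emultiplicity,
          emultiplicity_eq_count_normalizedFactors hirr hf.ne_zero, hmon.normalize_eq_self]
        norm_cast
      have hcard := card_filter_minpoly_eq (K := GaloisField p n) hirr hmon
      rw [GaloisField.finrank p hn0] at hcard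
      rw [Finset.filter_filter]
      by_cases h : n / P.natDegree ≤ (normalizedFactors f).count P
      · rw [← hiff] at h
        simp only [hiff.1 h, and_true]
        rw [← hcard]
        congr 1
        ext x
        simp only [Finset.mem_filter, Finset.mem_univ, true_and, and_iff_right_iff_imp]
        rintro rfl
        exact h
      · simp only [h, and_false, if_false, Finset.card_eq_zero, Finset.filter_eq_empty_iff]
        rintro x _ ⟨h1, rfl⟩
        exact h (hiff.1 h1)
    · intro x hx
      have hx := (Finset.mem_filter.1 (Finset.mem_coe.1 hx)).2
      have hint : IsIntegral (ZMod p) x := Algebra.IsIntegral.isIntegral x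
      rw [Finset.mem_coe, hmem]
      refine ⟨minpoly.irreducible hint, minpoly.monic hint, dvd_trans (dvd_pow_self _ ?_) hx⟩
      have h1 := minpoly.degree_dvd hint
      rw [GaloisField.finrank p hn0] at h1
      exact (Nat.div_pos (Nat.le_of_dvd (by omega) h1) (minpoly.natDegree_pos hint)).ne'
  rw [Finset.sum_congr rfl hfib, Finset.sum_comm]
  conv_rhs => rw [hdeg]
  refine Finset.sum_congr rfl fun P hP => ?_
  rw [← Finset.sum_filter, Finset.sum_const, smul_eq_mul, card_filter_dvd_div_le]
  · exact ((hmem P).1 hP).1.natDegree_pos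
  · rw [hdeg]
    exact Finset.single_le_sum (f := fun P => (normalizedFactors f).count P * P.natDegree)
      (fun _ _ => Nat.zero_le _) hP

lemma finite_monic_natDegree_eq (d : ℕ) : {f : (ZMod p)[X] | f.Monic ∧ f.natDegree = d}.Finite :=
  Set.finite_coe_iff.1 (Finite.of_equiv _ (monicEquivDegreeLT (R := ZMod p) d).symm)

/-- The monic polynomials of degree `d` over `ZMod p`. -/
noncomputable def monics (p : ℕ) [Fact p.Prime] (d : ℕ) : Finset (ZMod p)[X] :=
  (finite_monic_natDegree_eq d).toFinset

lemma mem_monics {d : ℕ} {f : (ZMod p)[X]} : f ∈ monics p d ↔ f.Monic ∧ f.natDegree = d := by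
  simp [monics]

/-- The coefficients of the `L`-function of the Kloosterman sum. -/
noncomputable def lCoeff (ψ : AddChar (ZMod p) ℂ) (a b : ZMod p) (d : ℕ) : ℂ :=
  ∑ f ∈ monics p d, kloostermanWeight ψ a b f

open Classical in
/-- The Kloosterman sum over the extension of degree `n` of `ZMod p`. -/
noncomputable def kloostermanSum (ψ : AddChar (ZMod p) ℂ) (a b : ZMod p) (n : ℕ) : ℂ :=
  ∑ x : GaloisField p n, if x = 0 then 0 else
    ψ (Algebra.trace (ZMod p) (GaloisField p n) (a • x + b • x⁻¹))

open Classical in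
lemma sum_monics_mul {d n : ℕ} (hnd : n ≤ d) {Q : (ZMod p)[X]} (hQ : Q.Monic)
    (hQn : Q.natDegree = n) (w : (ZMod p)[X] → ℂ) :
    ∑ g ∈ monics p (d - n), w (Q * g) = ∑ f ∈ (monics p d).filter (fun f => Q ∣ f), w f := by
  refine Finset.sum_bij (fun g _ => Q * g) ?_ ?_ ?_ (fun _ _ => rfl)
  · intro g hg
    rw [mem_monics] at hg
    rw [Finset.mem_filter, mem_monics]
    exact ⟨⟨hQ.mul hg.1, by rw [hQ.natDegree_mul hg.1, hQn, hg.2]; omega⟩, dvd_mul_right _ _⟩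
  · intro g _ g' _ h
    exact mul_left_cancel₀ hQ.ne_zero h
  · intro f hf
    rw [Finset.mem_filter, mem_monics] at hf
    obtain ⟨⟨h1, h2⟩, g, rfl⟩ := hf
    have hg : g.Monic := hQ.of_mul_monic_left h1
    refine ⟨g, mem_monics.2 ⟨hg, ?_⟩, rfl⟩
    rw [hQ.natDegree_mul hg, hQn] at h2
    omega

/-- The logarithmic derivative of the Euler product, coefficientwise. -/
lemma sum_kloostermanSum_mul_lCoeff (ψ : AddChar (ZMod p) ℂ) (a b : ZMod p) (d : ℕ) :
    ∑ n ∈ Finset.Icc 1 d, kloostermanSum ψ a b n * lCoeff ψ a b (d - n) =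
      d * lCoeff ψ a b d := by
  classical
  have h1 : ∀ n ∈ Finset.Icc 1 d, kloostermanSum ψ a b n * lCoeff ψ a b (d - n) =
      ∑ f ∈ monics p d, ((Finset.univ.filter fun x : GaloisField p n =>
        minpolyPow (ZMod p) n x ∣ f).card : ℂ) * kloostermanWeight ψ a b f := by
    intro n hn
    rw [Finset.mem_Icc] at hn
    have hn0 : n ≠ 0 := by omega
    have h2 : ∀ x : GaloisField p n, (if x = 0 then 0 else
        ψ (Algebra.trace (ZMod p) (GaloisField p n) (a • x + b • x⁻¹))) * lCoeff ψ a b (d - n) =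
        ∑ f ∈ monics p d, if minpolyPow (ZMod p) n x ∣ f then kloostermanWeight ψ a b f else 0 := by
      intro x
      obtain ⟨hm, hd⟩ := minpolyPow_monic_natDegree hn0 x
      have h3 := kloostermanWeight_minpolyPow ψ a b x
      rw [GaloisField.finrank p hn0] at h3
      rw [← h3, lCoeff, Finset.mul_sum, ← Finset.sum_filter, ← sum_monics_mul hn.2 hm hd]
      refine Finset.sum_congr rfl fun g hg => ?_
      rw [kloostermanWeight_mul _ _ _ hm (mem_monics.1 hg).1]
    rw [kloostermanSum, Finset.sum_mul, Finset.sum_congr rfl fun x _ => h2 x, Finset.sum_comm]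
    refine Finset.sum_congr rfl fun f _ => ?_
    rw [← Finset.sum_filter, Finset.sum_const, nsmul_eq_mul]
  rw [Finset.sum_congr rfl h1, Finset.sum_comm, lCoeff, Finset.mul_sum]
  refine Finset.sum_congr rfl fun f hf => ?_
  obtain ⟨hm, hd⟩ := mem_monics.1 hf
  rw [← Finset.sum_mul, ← Nat.cast_sum, ← hd, sum_card_minpolyPow_dvd hm]

lemma lCoeff_zero (ψ : AddChar (ZMod p) ℂ) (a b : ZMod p) : lCoeff ψ a b 0 = 1 := by
  have : monics p 0 = {1} := by
    ext f
    rw [mem_monics, Finset.mem_singleton]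
    exact ⟨fun h => h.1.natDegree_eq_zero.1 h.2, fun h => by simp [h]⟩
  rw [lCoeff, this, Finset.sum_singleton, kloostermanWeight_one]

lemma lCoeff_two {ψ : AddChar (ZMod p) ℂ} (hψ : ψ.IsPrimitive) {a b : ZMod p} (ha : a ≠ 0)
    (hb : b ≠ 0) : lCoeff ψ a b 2 = p := by
  have hquad : ∀ u v : ZMod p, (X ^ 2 + C u * X + C v : (ZMod p)[X]).natDegree = 2 := by
    intro u v
    have := natDegree_quadratic (a := (1 : ZMod p)) (b := u) (c := v) one_ne_zero
    rwa [C_1, one_mul] at this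
  have hsum : lCoeff ψ a b 2 = ∑ z : ZMod p × ZMod p,
      if z.2 = 0 then 0 else ψ (z.1 * -(a + b / z.2)) := by
    rw [lCoeff]
    refine Finset.sum_bij' (fun f _ => (f.coeff 1, f.coeff 0))
      (fun z _ => X ^ 2 + C z.1 * X + C z.2) (fun _ _ => Finset.mem_univ _) ?_ ?_ ?_ ?_
    · rintro ⟨u, v⟩ _
      rw [mem_monics]
      refine ⟨?_, hquad u v⟩
      rw [Monic, leadingCoeff, hquad]
      simp
    · intro f hf
      obtain ⟨hm, hd⟩ := mem_monics.1 hf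
      have := hm.as_sum
      rw [hd] at this
      conv_rhs => rw [this]
      simp only [Finset.sum_range_succ, Finset.sum_range_zero, pow_zero, mul_one, zero_add, pow_one]
      ring
    · rintro ⟨u, v⟩ _
      simp [coeff_X]
    · intro f hf
      obtain ⟨hm, hd⟩ := mem_monics.1 hf
      simp only [kloostermanWeight]
      split_ifs with h0
      · rfl
      · rw [nextCoeff_of_natDegree_pos (by omega), hd]
        congr 1
        field_simp
  rw [hsum, Fintype.sum_prod_type_right]
  have hin : ∀ v : ZMod p, (∑ u : ZMod p, if v = 0 then 0 else ψ (u * -(a + b / v))) =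
      if v = -b / a then (p : ℂ) else 0 := by
    intro v
    by_cases hv : v = 0
    · have : (0 : ZMod p) ≠ -b / a := (div_ne_zero (neg_ne_zero.2 hb) ha).symm
      simp [hv, this]
    · simp only [hv, if_false]
      rw [AddChar.sum_mulShift _ hψ, ZMod.card]
      have : -(a + b / v) = 0 ↔ v = -b / a := by
        field_simp
        constructor
        · intro h; linear_combination -h
        · intro h; linear_combination -h
      simp only [this]
      split_ifs <;> simp
  rw [Finset.sum_congr rfl fun v _ => hin v]
  simp

lemma lCoeff_eq_zero {ψ : AddChar (ZMod p) ℂ} (hψ : ψ.IsPrimitive) {a b : ZMod p} (ha : a ≠ 0)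
    {d : ℕ} (hd : 3 ≤ d) : lCoeff ψ a b d = 0 := by
  obtain ⟨t, ht⟩ := (AddChar.ne_one_iff).1 (hψ ha)
  rw [AddChar.mulShift_apply] at ht
  have hmem : ∀ (s : ZMod p) (f : (ZMod p)[X]), f ∈ monics p d →
      f + C s * X ^ (d - 1) ∈ monics p d := by
    intro s f hf
    obtain ⟨hm, hfd⟩ := mem_monics.1 hf
    have hlt : (C s * X ^ (d - 1)).degree < f.degree := by
      refine (degree_C_mul_X_pow_le _ _).trans_lt ?_
      rw [degree_eq_natDegree hm.ne_zero, hfd]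
      norm_cast
      omega
    rw [mem_monics]
    exact ⟨hm.add_of_left hlt, by rw [natDegree_add_eq_left_of_degree_lt hlt, hfd]⟩
  have hshift : lCoeff ψ a b d = ψ (a * t) * lCoeff ψ a b d := by
    conv_rhs => rw [lCoeff, Finset.mul_sum]
    rw [lCoeff]
    refine Finset.sum_bij' (fun f _ => f + C t * X ^ (d - 1)) (fun f _ => f + C (-t) * X ^ (d - 1))
      (fun f hf => hmem _ _ hf) (fun f hf => hmem _ _ hf) ?_ ?_ ?_
    · intro f _
      rw [C_neg]; ring
    · intro f _
      rw [C_neg]; ring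
    · intro f hf
      have h1 := (mem_monics.1 hf).2
      have h2 := (mem_monics.1 (hmem t f hf)).2
      have hc0 : (f + C t * X ^ (d - 1)).coeff 0 = f.coeff 0 := by
        rw [coeff_add, coeff_C_mul_X_pow, if_neg (by omega), add_zero]
      have hc1 : (f + C t * X ^ (d - 1)).coeff 1 = f.coeff 1 := by
        rw [coeff_add, coeff_C_mul_X_pow, if_neg (by omega), add_zero]
      have hcd : (f + C t * X ^ (d - 1)).nextCoeff = f.nextCoeff + t := by
        rw [nextCoeff_of_natDegree_pos (by omega), nextCoeff_of_natDegree_pos (by omega), h1, h2,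
          coeff_add, coeff_C_mul_X_pow, if_pos rfl]
      simp only [kloostermanWeight, hc0, hc1, hcd]
      split_ifs
      · simp
      · rw [← AddChar.map_add_eq_mul]
        congr 1
        ring
  have : (1 - ψ (a * t)) * lCoeff ψ a b d = 0 := by linear_combination hshift
  exact (mul_eq_zero.1 this).resolve_left (sub_ne_zero.2 ht.symm)

lemma kloostermanSum_two {ψ : AddChar (ZMod p) ℂ} (hψ : ψ.IsPrimitive) {a b : ZMod p} (ha : a ≠ 0)
    (hb : b ≠ 0) : kloostermanSum ψ a b 2 = 2 * p - kloostermanSum ψ a b 1 ^ 2 := by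
  have h1 := sum_kloostermanSum_mul_lCoeff ψ a b 1
  have h2 := sum_kloostermanSum_mul_lCoeff ψ a b 2
  simp only [Finset.sum_Icc_succ_top (show 1 ≤ 1 + 1 by omega), Finset.Icc_self,
    Finset.sum_singleton, Nat.sub_self, lCoeff_zero, Nat.cast_one, mul_one, one_mul,
    lCoeff_two hψ ha hb, Nat.cast_ofNat] at h1 h2
  rw [← h1] at h2
  linear_combination h2

lemma kloostermanSum_add_three {ψ : AddChar (ZMod p) ℂ} (hψ : ψ.IsPrimitive) {a b : ZMod p}
    (ha : a ≠ 0) (hb : b ≠ 0) (n : ℕ) :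
    kloostermanSum ψ a b (n + 3) =
      -kloostermanSum ψ a b 1 * kloostermanSum ψ a b (n + 2) - p * kloostermanSum ψ a b (n + 1) := by
  have h1 := sum_kloostermanSum_mul_lCoeff ψ a b 1
  have h2 := sum_kloostermanSum_mul_lCoeff ψ a b (n + 3)
  simp only [Finset.Icc_self, Finset.sum_singleton, Nat.sub_self, lCoeff_zero, Nat.cast_one,
    mul_one, one_mul] at h1
  rw [Finset.sum_Icc_succ_top (by omega), Finset.sum_Icc_succ_top (by omega),
    Finset.sum_Icc_succ_top (by omega), lCoeff_eq_zero hψ ha (show 3 ≤ n + 3 by omega)] at h2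
  have h0 : ∑ k ∈ Finset.Icc 1 n, kloostermanSum ψ a b k * lCoeff ψ a b (n + 3 - k) = 0 := by
    refine Finset.sum_eq_zero fun k hk => ?_
    have := (Finset.mem_Icc.1 hk).2
    rw [lCoeff_eq_zero hψ ha (show 3 ≤ n + 3 - k by omega), mul_zero]
  rw [h0, show n + 3 - (n + 1) = 2 by omega, show n + 3 - (n + 1 + 1) = 1 by omega,
    show n + 3 - (n + 2 + 1) = 0 by omega, lCoeff_two hψ ha hb, lCoeff_zero, ← h1] at h2
  linear_combination h2

lemma conj_kloostermanSum (ψ : AddChar (ZMod p) ℂ) (a b : ZMod p) (n : ℕ) :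
    (starRingEnd ℂ) (kloostermanSum ψ a b n) = kloostermanSum ψ a b n := by
  classical
  rw [kloostermanSum, map_sum]
  refine Fintype.sum_equiv (Equiv.neg _) _ _ fun x => ?_
  simp only [Equiv.neg_apply, neg_eq_zero]
  split_ifs
  · simp
  · rw [← AddChar.map_neg_eq_conj]
    congr 1
    rw [inv_neg, smul_neg, smul_neg, ← neg_add, map_neg]

end Recurrence

section WeilBound

lemma eq_pow_add_pow_of_recurrence {R : Type*} [CommRing R] {V : ℕ → R} {α β : R}
    (h1 : V 1 = α + β) (h2 : V 2 = α ^ 2 + β ^ 2)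
    (h3 : ∀ n, V (n + 3) = (α + β) * V (n + 2) - α * β * V (n + 1)) (n : ℕ) :
    V (n + 1) = α ^ (n + 1) + β ^ (n + 1) := by
  induction n using Nat.twoStepInduction with
  | zero => simpa using h1
  | one => exact h2
  | more n ih1 ih2 =>
    rw [h3, ih1, ih2]
    ring

lemma exists_real_roots {c q : ℝ} (h : 4 * q < c ^ 2) :
    ∃ α β : ℝ, c = α + β ∧ q = α * β := by
  have hs := Real.mul_self_sqrt (sub_nonneg.2 h.le)
  refine ⟨(c + √(c ^ 2 - 4 * q)) / 2, (c - √(c ^ 2 - 4 * q)) / 2, by ring, ?_⟩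
  linear_combination hs / 4

lemma exists_complex_root {c q : ℝ} (h : c ^ 2 ≤ 4 * q) :
    ∃ α : ℂ, (c : ℂ) = α + (starRingEnd ℂ) α ∧ (q : ℂ) = α * (starRingEnd ℂ) α := by
  have hs := Real.mul_self_sqrt (sub_nonneg.2 h)
  refine ⟨⟨c / 2, √(4 * q - c ^ 2) / 2⟩, ?_, ?_⟩
  · apply Complex.ext <;> simp
  · rw [Complex.mul_conj, Complex.normSq_mk]
    norm_cast
    linear_combination -hs / 4

lemma le_of_recurrence {V : ℕ → ℝ} {q : ℝ} (h2 : V 2 = V 1 ^ 2 - 2 * q)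
    (h3 : ∀ n, V (n + 3) = V 1 * V (n + 2) - q * V (n + 1)) (hq : 0 ≤ q) {k : ℕ} (hk : k ≠ 0) :
    -(2 * q ^ k) ≤ V (2 * k) := by
  obtain ⟨l, hl⟩ : ∃ l, 2 * k = l + 1 := ⟨2 * k - 1, by omega⟩
  obtain h | h := lt_or_ge (4 * q) (V 1 ^ 2)
  · obtain ⟨α, β, hc, hq'⟩ := exists_real_roots h
    have hV := eq_pow_add_pow_of_recurrence hc (by rw [h2, hc, hq']; ring)
      (fun n => by rw [h3, ← hc, ← hq']) l
    rw [hl, hV, ← hl, pow_mul', pow_mul']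
    linarith [pow_nonneg hq k, sq_nonneg (α ^ k), sq_nonneg (β ^ k)]
  · obtain ⟨α, hc, hq'⟩ := exists_complex_root h
    have hV := eq_pow_add_pow_of_recurrence (V := fun n => (V n : ℂ)) hc
      (by simp only [h2]; push_cast; rw [hc, hq']; ring)
      (fun n => by simp only [h3]; push_cast; rw [← hc, ← hq']) l
    have hα : ‖α‖ ^ 2 = q := by
      rw [Complex.mul_conj, Complex.normSq_eq_norm_sq] at hq'
      exact_mod_cast hq'.symm
    rw [← hl, ← map_pow, Complex.add_conj] at hV
    have hV' : V (2 * k) = 2 * (α ^ (2 * k)).re := by exact_mod_cast hV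
    have h4 := (abs_le.1 (Complex.abs_re_le_norm (α ^ (2 * k)))).1
    rw [norm_pow, pow_mul, hα] at h4
    linarith

lemma exists_pow_le_of_recurrence {V : ℕ → ℝ} {q : ℝ} (h2 : V 2 = V 1 ^ 2 - 2 * q)
    (h3 : ∀ n, V (n + 3) = V 1 * V (n + 2) - q * V (n + 1)) (h : 4 * q < V 1 ^ 2) :
    ∃ R, q < R ∧ ∀ k ≠ 0, R ^ k ≤ V (2 * k) := by
  obtain ⟨α, β, hc, hq'⟩ := exists_real_roots h
  refine ⟨max (α ^ 2) (β ^ 2), ?_, fun k hk => ?_⟩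
  · rw [hc, hq'] at h
    rw [lt_max_iff, hq']
    by_contra! h'
    nlinarith
  · obtain ⟨l, hl⟩ : ∃ l, 2 * k = l + 1 := ⟨2 * k - 1, by omega⟩
    have hV := eq_pow_add_pow_of_recurrence hc (by rw [h2, hc, hq']; ring)
      (fun n => by rw [h3, ← hc, ← hq']) l
    rw [hl, hV, ← hl, pow_mul, pow_mul]
    rcases max_choice (α ^ 2) (β ^ 2) with h' | h' <;> rw [h']
    · linarith [pow_nonneg (sq_nonneg β) k]
    · linarith [pow_nonneg (sq_nonneg α) k]

variable {p : ℕ} [Fact p.Prime]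

lemma card_galoisField {n : ℕ} (hn : n ≠ 0) : Fintype.card (GaloisField p n) = p ^ n := by
  rw [← Nat.card_eq_fintype_card, GaloisField.card p n hn]

lemma re_kloostermanSum (ψ : AddChar (ZMod p) ℂ) (a b : ZMod p) (n : ℕ) :
    ((kloostermanSum ψ a b n).re : ℂ) = kloostermanSum ψ a b n :=
  Complex.conj_eq_iff_re.1 (conj_kloostermanSum ψ a b n)

lemma kloostermanSum_zero_zero (ψ : AddChar (ZMod p) ℂ) {n : ℕ} (hn : n ≠ 0) :
    kloostermanSum ψ 0 0 n = p ^ n - 1 := by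
  classical
  have h : ∀ x : GaloisField p n, (if x = 0 then 0 else
      ψ (Algebra.trace (ZMod p) (GaloisField p n) ((0 : ZMod p) • x + (0 : ZMod p) • x⁻¹))) =
      1 - if x = 0 then (1 : ℂ) else 0 := by
    intro x
    split_ifs <;> simp
  unfold kloostermanSum
  rw [Finset.sum_congr rfl fun x _ => by convert h x, Finset.sum_sub_distrib]
  simp [card_galoisField hn]

open Classical in
lemma sum_kloostermanSum_mul {ψ : AddChar (ZMod p) ℂ} (hψ : ψ.IsPrimitive) (a b : ZMod p) (n : ℕ) :
    ∑ t, kloostermanSum ψ (t * a) (t * b) n = p * (Finset.univ.filter fun x : GaloisField p n =>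
      x ≠ 0 ∧ Algebra.trace (ZMod p) (GaloisField p n) (a • x + b • x⁻¹) = 0).card := by
  unfold kloostermanSum
  rw [Finset.sum_comm, Finset.card_filter, Nat.cast_sum, Finset.mul_sum]
  refine Finset.sum_congr rfl fun x _ => ?_
  by_cases hx : x = 0
  · simp [hx]
  have h : ∀ t : ZMod p, Algebra.trace (ZMod p) (GaloisField p n) ((t * a) • x + (t * b) • x⁻¹) =
      t * Algebra.trace (ZMod p) (GaloisField p n) (a • x + b • x⁻¹) := by
    intro t
    rw [mul_smul, mul_smul, ← smul_add, map_smul, smul_eq_mul]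
  simp only [hx, if_false, h, AddChar.sum_mulShift _ hψ, ZMod.card, ne_eq, not_false_eq_true,
    true_and]
  split_ifs <;> simp

/-- The Weil bound, in the form `S ^ 2 ≤ 4 * p` for the (real) Kloosterman sum `S`. -/
theorem re_kloostermanSum_one_sq_le (hp2 : p ≠ 2) {ψ : AddChar (ZMod p) ℂ} (hψ : ψ.IsPrimitive)
    {a b : ZMod p} (ha : a ≠ 0) (hb : b ≠ 0) : (kloostermanSum ψ a b 1).re ^ 2 ≤ 4 * p := by
  classical
  have hp : p.Prime := Fact.out
  have hp3 : 3 ≤ p := by have := hp.two_le; omega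
  set V : ZMod p → ℕ → ℝ := fun t n => -(kloostermanSum ψ (t * a) (t * b) n).re with hV
  have h2 : ∀ t ≠ 0, V t 2 = V t 1 ^ 2 - 2 * p := by
    intro t ht
    have h := kloostermanSum_two hψ (mul_ne_zero ht ha) (mul_ne_zero ht hb)
    have h' : (kloostermanSum ψ (t * a) (t * b) 2).re = 2 * p -
        (kloostermanSum ψ (t * a) (t * b) 1).re ^ 2 := by
      apply Complex.ofReal_injective
      push_cast
      simpa only [re_kloostermanSum] using h
    simp only [hV, h']
    ring
  have h3 : ∀ t ≠ 0, ∀ n, V t (n + 3) = V t 1 * V t (n + 2) - p * V t (n + 1) := by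
    intro t ht n
    have h := kloostermanSum_add_three hψ (mul_ne_zero ht ha) (mul_ne_zero ht hb) n
    have h' : (kloostermanSum ψ (t * a) (t * b) (n + 3)).re =
        -(kloostermanSum ψ (t * a) (t * b) 1).re * (kloostermanSum ψ (t * a) (t * b) (n + 2)).re -
        p * (kloostermanSum ψ (t * a) (t * b) (n + 1)).re := by
      apply Complex.ofReal_injective
      push_cast
      simpa only [re_kloostermanSum] using h
    simp only [hV, h']
    ring
  have hsum : ∀ k, 3 ≤ k → ∑ t ∈ Finset.univ.erase 0, V t (2 * k) ≤ 10 * p * (p : ℝ) ^ k := by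
    intro k hk
    obtain ⟨r, hr⟩ := (hp.odd_of_ne_two hp2).pow (n := k)
    have hP : 4 * p < 2 * r + 1 := by
      rw [← hr]
      calc 4 * p < p ^ 2 * p := Nat.mul_lt_mul_of_pos_right (by nlinarith) hp.pos
        _ = p ^ 3 := by ring
        _ ≤ p ^ k := Nat.pow_le_pow_right hp.pos hk
    have hcard := card_le_mul_card_trace_eq_zero hp2 (K := GaloisField p (2 * k)) hr
      (by rw [card_galoisField (by omega), ← hr, ← pow_mul, mul_comm]) hP ha hb
    rw [← hr] at hcard
    have hS := sum_kloostermanSum_mul hψ a b (2 * k)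
    have hS' : ∑ t, (kloostermanSum ψ (t * a) (t * b) (2 * k)).re =
      p * (Finset.univ.filter fun x : GaloisField p (2 * k) => x ≠ 0 ∧
        Algebra.trace (ZMod p) (GaloisField p (2 * k)) (a • x + b • x⁻¹) = 0).card := by
      apply Complex.ofReal_injective
      push_cast
      simpa only [re_kloostermanSum] using hS
    have h0 : (kloostermanSum ψ ((0 : ZMod p) * a) (0 * b) (2 * k)).re = p ^ (2 * k) - 1 := by
      rw [zero_mul, zero_mul, kloostermanSum_zero_zero ψ (by omega)]
      norm_cast
    rw [← Finset.add_sum_erase _ _ (Finset.mem_univ (0 : ZMod p)), h0] at hS'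
    have hcard' : ((p : ℝ) ^ k) ^ 2 ≤ p * (Finset.univ.filter fun x : GaloisField p (2 * k) =>
        x ≠ 0 ∧ Algebra.trace (ZMod p) (GaloisField p (2 * k)) (a • x + b • x⁻¹) = 0).card +
        10 * p * p ^ k := by exact_mod_cast hcard
    rw [← pow_mul, mul_comm k 2] at hcard'
    simp only [hV, Finset.sum_neg_distrib]
    linarith
  by_contra! hlt
  obtain ⟨R, hR, hRk⟩ := exists_pow_le_of_recurrence (h2 1 one_ne_zero) (h3 1 one_ne_zero)
    (by simpa [hV] using hlt)
  have hp0 : (0 : ℝ) < p := by exact_mod_cast hp.pos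
  have hbound : ∀ k, 3 ≤ k → (R / p) ^ k ≤ 12 * p := by
    intro k hk
    have hpk : (0 : ℝ) < p ^ k := by positivity
    rw [div_pow, div_le_iff₀ hpk]
    refine (hRk k (by omega)).trans ?_
    have hle : ∀ t ∈ Finset.univ.erase (0 : ZMod p), 0 ≤ V t (2 * k) + 2 * p ^ k := by
      intro t ht
      have := le_of_recurrence (h2 t (Finset.ne_of_mem_erase ht)) (h3 t (Finset.ne_of_mem_erase ht))
        hp0.le (k := k) (by omega)
      linarith
    have h1 := Finset.single_le_sum hle (Finset.mem_erase.2 ⟨one_ne_zero, Finset.mem_univ 1⟩)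
    rw [Finset.sum_add_distrib, Finset.sum_const, nsmul_eq_mul] at h1
    have hc : ((Finset.univ.erase (0 : ZMod p)).card : ℝ) ≤ p := by
      exact_mod_cast (Finset.card_le_univ _).trans (ZMod.card p).le
    have := hsum k hk
    nlinarith
  obtain ⟨k, hk⟩ := (((tendsto_pow_atTop_atTop_of_one_lt ((one_lt_div hp0).2 hR)).eventually_gt_atTop
    (12 * p)).and (Filter.eventually_ge_atTop 3)).exists
  exact absurd (hbound k hk.2) (not_le.2 hk.1)

lemma kloostermanSum_one (ψ : AddChar (ZMod p) ℂ) (a b : ZMod p) :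
    kloostermanSum ψ a b 1 = ∑ γ : (ZMod p)ˣ, ψ (a * γ + b * (γ⁻¹ : (ZMod p)ˣ)) := by
  classical
  have h : ∀ x : GaloisField p 1,
      (if x = 0 then 0 else
        ψ (Algebra.trace (ZMod p) (GaloisField p 1) (a • x + b • x⁻¹))) =
      (fun y : ZMod p => if y = 0 then 0 else ψ (a * y + b * y⁻¹)) (GaloisField.equivZmodP p x) := by
    intro x
    simp only [EmbeddingLike.map_eq_zero_iff]
    rw [← Algebra.trace_eq_of_algEquiv (GaloisField.equivZmodP p), Algebra.trace_self_apply]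
    simp
  unfold kloostermanSum
  rw [Finset.sum_congr rfl fun x _ => by convert h x,
    (GaloisField.equivZmodP p).bijective.sum_comp
      (fun y : ZMod p => if y = 0 then 0 else ψ (a * y + b * y⁻¹)),
    ← Finset.add_sum_erase _ _ (Finset.mem_univ (0 : ZMod p)), if_pos rfl, zero_add]
  symm
  refine Finset.sum_bij (fun γ _ => (γ : ZMod p)) (by simp) (fun _ _ _ _ h => Units.ext h)
    (fun y hy => ⟨Units.mk0 y (by simpa using hy), Finset.mem_univ _, rfl⟩) fun γ _ => ?_
  rw [if_neg γ.ne_zero, Units.val_inv_eq_inv_val]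

lemma sum_units_addChar {ψ : AddChar (ZMod p) ℂ} (hψ : ψ.IsPrimitive) {b : ZMod p} (hb : b ≠ 0) :
    ∑ γ : (ZMod p)ˣ, ψ (b * (γ⁻¹ : (ZMod p)ˣ)) = -1 := by
  classical
  refine (Equiv.sum_comp (Equiv.inv (ZMod p)ˣ) fun γ : (ZMod p)ˣ => ψ (b * γ)).trans ?_
  have h := AddChar.sum_mulShift b hψ
  rw [if_neg hb, ← Finset.add_sum_erase _ _ (Finset.mem_univ (0 : ZMod p)), zero_mul,
    AddChar.map_zero_eq_one] at h
  rw [eq_neg_iff_add_eq_zero, add_comm, ← Nat.cast_zero, ← h]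
  congr 1
  refine Finset.sum_bij (fun γ _ => (γ : ZMod p)) (by simp) (fun _ _ _ _ h => Units.ext h)
    (fun y hy => ⟨Units.mk0 y (by simpa using hy), Finset.mem_univ _, rfl⟩) fun γ _ => ?_
  rw [mul_comm]

theorem norm_sum_addChar_le {ψ : AddChar (ZMod p) ℂ} (hψ : ψ.IsPrimitive) (a : ZMod p)
    {b : ZMod p} (hb : b ≠ 0) :
    ‖∑ γ : (ZMod p)ˣ, ψ (a * γ + b * (γ⁻¹ : (ZMod p)ˣ))‖ ≤ 2 * √p := by
  have hp : p.Prime := Fact.out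
  have h1 : 1 ≤ √(p : ℝ) := Real.one_le_sqrt.2 (by exact_mod_cast hp.one_le)
  by_cases ha : a = 0
  · simp only [ha, zero_mul, zero_add, sum_units_addChar hψ hb, norm_neg, norm_one]
    linarith
  by_cases hp2 : p = 2
  · subst hp2
    refine (norm_sum_le _ _).trans ?_
    simp only [AddChar.norm_apply, Finset.sum_const, Finset.card_univ, ZMod.card_units]
    simp only [Nat.cast_ofNat] at h1 ⊢
    norm_num
    linarith
  rw [← kloostermanSum_one, ← re_kloostermanSum, Complex.norm_real, Real.norm_eq_abs]
  refine abs_le_of_sq_le_sq ?_ (by positivity)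
  rw [mul_pow, Real.sq_sqrt (by positivity)]
  linarith [re_kloostermanSum_one_sq_le hp2 hψ ha hb]

end WeilBound

end

/-- Weil bound: for a prime `p` and integers `m, n` with `gcd(n,p)=1`,
the Kloosterman sum `∑*_{γ mod p} e((mγ + nγ̄)/p)` has absolute value at most
`2·gcd(m,n,p)^{1/2}·p^{1/2}`. -/
theorem stmt5 (p : ℕ) [NeZero p] (hp : p.Prime) (m n : ℤ) (hn : Int.gcd n p = 1) :
    ‖∑ γ : (ZMod p)ˣ,
        e (((m * ((γ : ZMod p).val : ℤ) + n * (((γ⁻¹ : (ZMod p)ˣ) : ZMod p).val : ℤ)) : ℤ)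
          / (p : ℝ))‖ ≤
      2 * Real.sqrt (Int.gcd m (Int.gcd n p)) * Real.sqrt p := by
  have : Fact p.Prime := ⟨hp⟩
  have hn0 : (n : ZMod p) ≠ 0 := by
    rw [Ne, ZMod.intCast_zmod_eq_zero_iff_dvd]
    intro h
    rw [Int.gcd_eq_natAbs_right h] at hn
    exact hp.one_lt.ne' (by simpa using hn)
  have he : ∀ j : ℤ, e (j / (p : ℝ)) = ZMod.stdAddChar (N := p) j := by
    intro j
    rw [ZMod.stdAddChar_coe, e]
    push_cast
    ring_nf
  simp only [he]
  push_cast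
  simp only [ZMod.natCast_zmod_val]
  rw [hn, Nat.cast_one, Int.gcd_one, Nat.cast_one, Real.sqrt_one, mul_one]
  simpa only [Units.val_inv_eq_inv_val] using
    norm_sum_addChar_le (ZMod.isPrimitive_stdAddChar p) (m : ZMod p) hn0
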